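/- Define a sequence (a_n)_{n≥0} in F_2 by a_n = 1 if n = 2^{4^k ℓ} for some integer k ≥ 0 and some odd integer ℓ ≥ 1, and a_n = 0 otherwise. Then the Laurent series Σ_{n=0}^∞ a_n T^{-n} ∈ F_2((T^{-1})) is a T-number. -/

import Mathlib

open Polynomial Filter Set
open scoped Classical

noncomputable section

namespace OotoT

variable (Fq : Type) [Field Fq]

/-- We model the field `F_q((T⁻¹))` of Laurent series in `T⁻¹` as `LaurentSeries Fq`,
whose canonical variable `u` plays the role of `T⁻¹`.  Thus `T` itself is `u⁻¹`. -/
def Tel : LaurentSeries Fq := (HahnSeries.single (1 : ℤ) (1 : Fq))⁻¹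

/-- The canonical ring embedding `F_q[T] → F_q((T⁻¹))`, sending `T ↦ u⁻¹`. -/
def ringHomT : Polynomial Fq →+* LaurentSeries Fq :=
  Polynomial.eval₂RingHom (HahnSeries.C : Fq →+* LaurentSeries Fq) (Tel Fq)

/-- The absolute value on `F_q((T⁻¹))`: `|0| = 0` and `|ξ| = q^{-N}` where
`ξ = Σ_{n ≥ N} a_n T^{-n}` with `a_N ≠ 0`; in our model `N` is the order of `ξ`
as a Hahn series in `u = T⁻¹`. -/
def absL (q : ℕ) (ξ : LaurentSeries Fq) : ℝ :=
  if ξ = 0 then 0 else (q : ℝ) ^ (-ξ.order)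

/-- Evaluation of a polynomial `P(X) ∈ (F_q[T])[X]` at `ξ ∈ F_q((T⁻¹))`. -/
def evalP (ξ : LaurentSeries Fq) (P : Polynomial (Polynomial Fq)) : LaurentSeries Fq :=
  Polynomial.eval₂ (ringHomT Fq) ξ P

/-- The height of `P(X) ∈ (F_q[T])[X]`: the maximum of the absolute values of its
coefficients.  A nonzero `c ∈ F_q[T]` has `|c| = q^{deg c}`, so for `P ≠ 0` the height
is `q` raised to the maximal degree of a (nonzero) coefficient of `P`. -/
def heightP (q : ℕ) (P : Polynomial (Polynomial Fq)) : ℝ :=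
  if P = 0 then 0 else (q : ℝ) ^ (P.support.sup fun i => (P.coeff i).natDegree)

/-- `w_n(ξ)`: the supremum (in the extended reals) of the real numbers `w` such that
`0 < |P(ξ)| ≤ H(P)^{-w}` for infinitely many `P(X) ∈ (F_q[T])[X]` of degree at most `n`. -/
def wn (q : ℕ) (n : ℕ) (ξ : LaurentSeries Fq) : EReal :=
  sSup ((fun w : ℝ => (w : EReal)) ''
    {w : ℝ | {P : Polynomial (Polynomial Fq) | P.natDegree ≤ n ∧
      0 < absL Fq q (evalP Fq ξ P) ∧
      absL Fq q (evalP Fq ξ P) ≤ heightP Fq q P ^ (-w)}.Infinite})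

/-- `w(ξ) = limsup_{n→∞} w_n(ξ)/n`. -/
def wB (q : ℕ) (ξ : LaurentSeries Fq) : EReal :=
  Filter.limsup (fun n : ℕ => wn Fq q n ξ / (n : EReal)) Filter.atTop

/-- `ξ` is an `A`-number if `w(ξ) = 0`. -/
def IsANumber (q : ℕ) (ξ : LaurentSeries Fq) : Prop := wB Fq q ξ = 0

/-- `ξ` is an `S`-number if `0 < w(ξ) < +∞`. -/
def IsSNumber (q : ℕ) (ξ : LaurentSeries Fq) : Prop := 0 < wB Fq q ξ ∧ wB Fq q ξ < ⊤

/-- `ξ` is a `T`-number if `w(ξ) = +∞` and `w_n(ξ) < +∞` for all `n ≥ 1`. -/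
def IsTNumber (q : ℕ) (ξ : LaurentSeries Fq) : Prop :=
  wB Fq q ξ = ⊤ ∧ ∀ n : ℕ, 1 ≤ n → wn Fq q n ξ < ⊤

/-- `ξ` is a `U`-number if `w(ξ) = +∞` and `w_n(ξ) = +∞` for some `n ≥ 1`. -/
def IsUNumber (q : ℕ) (ξ : LaurentSeries Fq) : Prop :=
  wB Fq q ξ = ⊤ ∧ ∃ n : ℕ, 1 ≤ n ∧ wn Fq q n ξ = ⊤

/-- The type `t(ξ) = limsup_{n→∞} (log w_n(ξ))/(log n)` of a `T`-number (as an
extended real; for a `T`-number each `w_n(ξ)` is a finite real, recovered by `toReal`). -/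
def typeT (q : ℕ) (ξ : LaurentSeries Fq) : EReal :=
  Filter.limsup
    (fun n : ℕ => ((Real.log (wn Fq q n ξ).toReal / Real.log n : ℝ) : EReal)) Filter.atTop

/-! ### The algebraic closure side -/

/-- The algebraic closure of `F_q((T⁻¹))`. -/
abbrev AC := AlgebraicClosure (LaurentSeries Fq)

/-- The canonical embedding of `F_q((T⁻¹))` into its algebraic closure. -/
def iota : LaurentSeries Fq →+* AC Fq := algebraMap _ _

/-- The embedding `F_q[T] → AC`. -/
def ringHomTC : Polynomial Fq →+* AC Fq := (iota Fq).comp (ringHomT Fq)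

/-- Evaluation of `P(X) ∈ (F_q[T])[X]` at an element of the algebraic closure. -/
def evalPC (α : AC Fq) (P : Polynomial (Polynomial Fq)) : AC Fq :=
  Polynomial.eval₂ (ringHomTC Fq) α P

/-- `P ∈ (F_q[T])[X]` is *the* minimal polynomial of `α`: it is non-constant, irreducible,
primitive, its leading coefficient is monic (in `T`), and `P(α) = 0`.  For `α` algebraic
over `F_q(T)` such a polynomial exists and is unique. -/
def IsMinPolyOf (α : AC Fq) (P : Polynomial (Polynomial Fq)) : Prop :=
  0 < P.natDegree ∧ Irreducible P ∧ P.IsPrimitive ∧ P.leadingCoeff.Monic ∧ evalPC Fq α P = 0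

/-- `α` is algebraic over `F_q(T)`. -/
def IsAlgT (α : AC Fq) : Prop := ∃ P, IsMinPolyOf Fq α P

/-- The degree of an algebraic `α`: the degree of its minimal polynomial. -/
def degT (α : AC Fq) : ℕ := if h : IsAlgT Fq α then h.choose.natDegree else 0

/-- The height of an algebraic `α`: the height of its minimal polynomial. -/
def heightT (q : ℕ) (α : AC Fq) : ℝ := if h : IsAlgT Fq α then heightP Fq q h.choose else 0

/-- The unique extension of the absolute value to the algebraic closure of `F_q((T⁻¹))`,
given by the standard formula `|x| = |N_{K(x)/K}(x)|^{1/[K(x):K]}`, i.e.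
`|x| = |c₀|^{1/d}` where `c₀` is the constant coefficient and `d` the degree of the
minimal polynomial of `x` over `K = F_q((T⁻¹))`. -/
def absC (q : ℕ) (x : AC Fq) : ℝ :=
  absL Fq q ((minpoly (LaurentSeries Fq) x).coeff 0) ^
    (((minpoly (LaurentSeries Fq) x).natDegree : ℝ)⁻¹)

/-- `w_n^*(ξ)`: the supremum (in the extended reals) of the real numbers `w` such that
`0 < |ξ - α| ≤ H(α)^{-w-1}` for infinitely many `α` algebraic over `F_q(T)` of degree
at most `n`. -/
def wnStar (q : ℕ) (n : ℕ) (ξ : LaurentSeries Fq) : EReal :=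
  sSup ((fun w : ℝ => (w : EReal)) ''
    {w : ℝ | {α : AC Fq | IsAlgT Fq α ∧ degT Fq α ≤ n ∧
      0 < absC Fq q (iota Fq ξ - α) ∧
      absC Fq q (iota Fq ξ - α) ≤ heightT Fq q α ^ (-w - 1)}.Infinite})

/-- `w^*(ξ) = limsup_{n→∞} w_n^*(ξ)/n`. -/
def wBStar (q : ℕ) (ξ : LaurentSeries Fq) : EReal :=
  Filter.limsup (fun n : ℕ => wnStar Fq q n ξ / (n : EReal)) Filter.atTop

/-- `ξ` is an `A*`-number if `w^*(ξ) = 0`. -/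
def IsAStarNumber (q : ℕ) (ξ : LaurentSeries Fq) : Prop := wBStar Fq q ξ = 0

/-- `ξ` is a `T*`-number if `w^*(ξ) = +∞` and `w_n^*(ξ) < +∞` for all `n ≥ 1`. -/
def IsTStarNumber (q : ℕ) (ξ : LaurentSeries Fq) : Prop :=
  wBStar Fq q ξ = ⊤ ∧ ∀ n : ℕ, 1 ≤ n → wnStar Fq q n ξ < ⊤

/-- The `*`-type `t^*(ξ) = limsup_{n→∞} (log w_n^*(ξ))/(log n)` of a `T*`-number. -/
def typeTStar (q : ℕ) (ξ : LaurentSeries Fq) : EReal :=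
  Filter.limsup
    (fun n : ℕ => ((Real.log (wnStar Fq q n ξ).toReal / Real.log n : ℝ) : EReal)) Filter.atTop

/-! ### The Laurent series `ξ(r, m)` -/

/-- `r_j = r^{m_0 m_1 ⋯ m_j}`. -/
def rr (r : ℕ) (m : ℕ → ℕ) (j : ℕ) : ℕ := r ^ (∏ i ∈ Finset.range (j + 1), m i)

/-- `α_j(r, m) = Σ_{n=1}^∞ T^{-r_j^n}`, i.e. the power series in `u = T⁻¹` whose
`k`-th coefficient is `1` exactly when `k = r_j^n` for some `n ≥ 1`. -/
def alphaJ (r : ℕ) (m : ℕ → ℕ) (j : ℕ) : LaurentSeries Fq :=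
  HahnSeries.ofPowerSeries ℤ Fq (PowerSeries.mk fun k =>
    if ∃ n : ℕ, 1 ≤ n ∧ k = rr r m j ^ n then 1 else 0)

/-- `ξ_a(r, m) = Σ_{j=0}^∞ a_j α_j(r, m)`, described coefficientwise: the coefficient of
`T^{-k}` is the (finite) sum over `j` of `a_j` times the coefficient of `T^{-k}` in
`α_j(r, m)`. -/
def xiA (r : ℕ) (m : ℕ → ℕ) (a : ℕ → ℕ) : LaurentSeries Fq :=
  HahnSeries.ofPowerSeries ℤ Fq (PowerSeries.mk fun k =>
    ∑ᶠ j : ℕ, (a j : Fq) * (if ∃ n : ℕ, 1 ≤ n ∧ k = rr r m j ^ n then 1 else 0))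

/-- `ξ(r, m) = Σ_{j=0}^∞ α_j(r, m)`. -/
def xi (r : ℕ) (m : ℕ → ℕ) : LaurentSeries Fq := xiA Fq r m fun _ => 1

/-! ### Algebraicity and algebraic dependence over `F_q(T)` for Laurent series -/

/-- `ξ ∈ F_q((T⁻¹))` is algebraic over `F_q(T)`. -/
def IsAlgLS (ξ : LaurentSeries Fq) : Prop :=
  ∃ P : Polynomial (Polynomial Fq), P ≠ 0 ∧ evalP Fq ξ P = 0

/-- Evaluation of a two-variable polynomial `F(X, Y) ∈ (F_q[T])[X, Y]` (coded as an
iterated polynomial ring, `T` innermost, then `X`, then `Y`) at `(ξ, η)`. -/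
def evalXY (ξ η : LaurentSeries Fq) (F : Polynomial (Polynomial (Polynomial Fq))) :
    LaurentSeries Fq :=
  Polynomial.eval₂ (Polynomial.eval₂RingHom (ringHomT Fq) ξ) η F

/-- `ξ` and `η` are algebraically dependent over `F_q(T)`. -/
def AlgDep (ξ η : LaurentSeries Fq) : Prop :=
  ∃ F : Polynomial (Polynomial (Polynomial Fq)), F ≠ 0 ∧ evalXY Fq ξ η F = 0

/-- `deg_X` of `F(X, Y) ∈ (F_q[T])[X, Y]` in our encoding. -/
def degX (F : Polynomial (Polynomial (Polynomial Fq))) : ℕ :=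
  F.support.sup fun i => (F.coeff i).natDegree

/-- `F(X, Y) ∈ (F_q[T])[X, Y]` is primitive (in `X` and `Y`): no non-unit of `F_q[T]`
divides all of its coefficients. -/
def IsPrimitiveXY (F : Polynomial (Polynomial (Polynomial Fq))) : Prop :=
  ∀ c : Polynomial Fq, (∀ i j : ℕ, c ∣ ((F.coeff i).coeff j)) → IsUnit c

end OotoT

open OotoT

namespace OotoT

theorem natDegree_resultant_le {R : Type*} [CommRing R] (f g : R[X][X]) (m n a b : ℕ)
    (hf : ∀ i, (f.coeff i).natDegree ≤ a) (hg : ∀ i, (g.coeff i).natDegree ≤ b) :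
    (resultant f g m n).natDegree ≤ m * b + n * a := by
  have hentry : ∀ i j, (sylvester f g m n i j).natDegree ≤
      Fin.addCases (motive := fun _ => ℕ) (fun _ => b) (fun _ => a) j := by
    intro i j
    induction j using Fin.addCases with
    | left j => simp only [sylvester, Matrix.of_apply, Fin.addCases_left]; split_ifs <;> simp [hg]
    | right j => simp only [sylvester, Matrix.of_apply, Fin.addCases_right]; split_ifs <;> simp [hf]
  rw [resultant, Matrix.det_apply]
  refine natDegree_sum_le_of_forall_le _ _ fun σ _ => ?_
  have hsmul : ∀ (z : ℤˣ) (p : R[X]), (z • p).natDegree = p.natDegree := by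
    intro z p
    rcases Int.units_eq_one_or z with rfl | rfl <;> simp
  rw [hsmul]
  refine (natDegree_prod_le _ _).trans ((Finset.sum_le_sum fun j _ => hentry (σ j) j).trans ?_)
  simp [Fin.sum_univ_add]

theorem resultant_ne_zero_of_irreducible_of_not_dvd {R : Type*} [CommRing R] [IsDomain R]
    [NormalizedGCDMonoid R] {p q : R[X]} (hp : Irreducible p) (hdeg : p.natDegree ≠ 0)
    (hpq : ¬ p ∣ q) : resultant p q ≠ 0 := by
  have hinj := IsFractionRing.injective R (FractionRing R)
  have hprim := hp.isPrimitive hdeg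
  intro h
  have h2 : resultant (p.map (algebraMap R (FractionRing R)))
      (q.map (algebraMap R (FractionRing R))) = 0 := by
    rw [natDegree_map_eq_of_injective hinj, natDegree_map_eq_of_injective hinj,
      resultant_map_map, h, map_zero]
  refine (resultant_eq_zero_iff.1 h2).2 ?_
  refine ((hprim.irreducible_iff_irreducible_map_fraction_map
    (K := FractionRing R)).1 hp).coprime_iff_not_dvd.2 fun hd => hpq ?_
  exact hprim.dvd_of_fraction_map_dvd_fraction_map hd

variable {F : Type*} [Field F]

/-- Evaluation of a polynomial over `F[u]` at a power series in `u`. -/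
def seriesEval (ξ : PowerSeries F) : F[X][X] →+* PowerSeries F :=
  eval₂RingHom coeToPowerSeries.ringHom ξ

theorem order_coe_le_natDegree {c : F[X]} (hc : c ≠ 0) :
    (c : PowerSeries F).order ≤ c.natDegree :=
  PowerSeries.order_le _ (by simpa using hc)

theorem order_seriesEval_le_of_not_dvd (ξ : PowerSeries F) {p q : F[X][X]} {a b : ℕ}
    (hp : Irreducible p) (hdeg : p.natDegree ≠ 0) (hpq : ¬ p ∣ q)
    (ha : ∀ i, (p.coeff i).natDegree ≤ a) (hb : ∀ i, (q.coeff i).natDegree ≤ b)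
    (hq : ((p.natDegree * b + q.natDegree * a : ℕ) : ℕ∞) < (seriesEval ξ q).order) :
    (seriesEval ξ p).order ≤ ((p.natDegree * b + q.natDegree * a : ℕ) : ℕ∞) := by
  obtain ⟨A, B, -, -, hAB⟩ := exists_mul_add_mul_eq_C_resultant p q le_rfl le_rfl (Or.inl hdeg)
  have hne := resultant_ne_zero_of_irreducible_of_not_dvd hp hdeg hpq
  have hR : ((resultant p q : F[X]) : PowerSeries F).order ≤
      ((p.natDegree * b + q.natDegree * a : ℕ) : ℕ∞) :=
    (order_coe_le_natDegree hne).trans (by exact_mod_cast natDegree_resultant_le p q _ _ a b ha hb)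
  by_contra! hlt
  have heq : ((resultant p q : F[X]) : PowerSeries F) =
      seriesEval ξ p * seriesEval ξ A + seriesEval ξ q * seriesEval ξ B := by
    rw [← map_mul, ← map_mul, ← map_add, hAB]
    simp [seriesEval]
  rw [heq] at hR
  refine absurd (hR.trans_lt (lt_min hlt hq)) (not_lt.2 ?_)
  refine le_trans (min_le_min ?_ ?_) (PowerSeries.min_order_le_order_add _ _)
  · rw [PowerSeries.order_mul]; exact le_self_add
  · rw [PowerSeries.order_mul]; exact le_self_add

/-- The degree of a bivariate polynomial in the inner variable. -/
def innerDegree (p : F[X][X]) : ℕ := (Bivariate.swap p).natDegree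

theorem coeff_coeff_swap (p : F[X][X]) (i j : ℕ) :
    ((Bivariate.swap p).coeff i).coeff j = (p.coeff j).coeff i := by
  induction p using Polynomial.induction_on' with
  | add p q hp hq => simp [hp, hq]
  | monomial n c =>
    induction c using Polynomial.induction_on' with
    | add p q hp hq => simp only [map_add, coeff_add, hp, hq]
    | monomial m r =>
      rw [Bivariate.swap_monomial_monomial]
      simp only [coeff_monomial]
      split_ifs <;> simp_all [coeff_monomial]

theorem natDegree_coeff_le_innerDegree (p : F[X][X]) (i : ℕ) :
    (p.coeff i).natDegree ≤ innerDegree p := by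
  refine natDegree_le_iff_coeff_eq_zero.2 fun N hN => ?_
  rw [← coeff_coeff_swap, coeff_eq_zero_of_natDegree_lt hN, coeff_zero]

theorem innerDegree_le {p : F[X][X]} {h : ℕ} (hp : ∀ i, (p.coeff i).natDegree ≤ h) :
    innerDegree p ≤ h := by
  refine natDegree_le_iff_coeff_eq_zero.2 fun N hN => ?_
  ext j
  rw [coeff_coeff_swap, coeff_zero, coeff_eq_zero_of_natDegree_lt ((hp j).trans_lt hN)]

theorem innerDegree_mul {p q : F[X][X]} (hp : p ≠ 0) (hq : q ≠ 0) :
    innerDegree (p * q) = innerDegree p + innerDegree q := by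
  rw [innerDegree, map_mul, natDegree_mul (by simpa using hp) (by simpa using hq)]
  rfl

/-- A bound for irreducible polynomials propagates to all polynomials. -/
theorem order_seriesEval_le_of_irreducible (ξ : PowerSeries F) (n W B : ℕ) (hW : 1 ≤ W)
    (hirr : ∀ p : F[X][X], Irreducible p → p.natDegree ≠ 0 → p.natDegree ≤ n →
      (seriesEval ξ p).order ≤ ((W * innerDegree p + B : ℕ) : ℕ∞))
    (p : F[X][X]) (hp : p ≠ 0) (hn : p.natDegree ≤ n) :
    (seriesEval ξ p).order ≤ ((W * innerDegree p + B * p.natDegree : ℕ) : ℕ∞) := by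
  have hconst : ∀ c : F[X], c ≠ 0 → (seriesEval ξ (C c)).order ≤
      ((W * innerDegree (C c) : ℕ) : ℕ∞) := by
    intro c hc
    have h1 : seriesEval ξ (C c) = (c : PowerSeries F) := by simp [seriesEval]
    rw [h1]
    refine (order_coe_le_natDegree hc).trans ?_
    have := natDegree_coeff_le_innerDegree (C c) 0
    rw [coeff_C_zero] at this
    exact_mod_cast this.trans (Nat.le_mul_of_pos_left _ hW)
  revert hn
  induction p using WfDvdMonoid.induction_on_irreducible with
  | zero => exact absurd rfl hp
  | unit u hu =>
    intro _
    obtain ⟨c, hc, rfl⟩ := Polynomial.isUnit_iff.1 hu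
    simpa using hconst c hc.ne_zero
  | mul a i ha hi ih =>
    intro hn
    rw [natDegree_mul hi.ne_zero ha] at hn ⊢
    rw [map_mul, PowerSeries.order_mul, innerDegree_mul hi.ne_zero ha]
    have h1 := ih ha (by omega)
    have h2 : (seriesEval ξ i).order ≤ ((W * innerDegree i + B * i.natDegree : ℕ) : ℕ∞) := by
      by_cases h0 : i.natDegree = 0
      · obtain ⟨c, rfl⟩ := natDegree_eq_zero.1 h0
        simpa using hconst c (by simpa using hi.ne_zero)
      · refine (hirr i hi h0 (by omega)).trans ?_
        have : B ≤ B * i.natDegree := Nat.le_mul_of_pos_right _ (Nat.pos_of_ne_zero h0)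
        exact_mod_cast by omega
    refine (add_le_add h2 h1).trans (le_of_eq ?_)
    push_cast
    ring

/-- The polynomial `X ^ D - X - c` where `c` is the truncation of `ξ ^ D - ξ` at `D ^ N`. -/
def approxPoly (ξ : PowerSeries F) (D N : ℕ) : F[X][X] :=
  X ^ D - X - C (PowerSeries.trunc (D ^ N + 1) (ξ ^ D - ξ))

theorem natDegree_approxPoly (ξ : PowerSeries F) {D : ℕ} (hD : 2 ≤ D) (N : ℕ) :
    (approxPoly ξ D N).natDegree = D := by
  rw [approxPoly, natDegree_sub_C, natDegree_sub_eq_left_of_natDegree_lt] <;> simp; omega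

theorem natDegree_coeff_approxPoly_le (ξ : PowerSeries F) (D N i : ℕ) :
    ((approxPoly ξ D N).coeff i).natDegree ≤ D ^ N := by
  have h := Nat.lt_succ_iff.1 (PowerSeries.natDegree_trunc_lt (ξ ^ D - ξ) (D ^ N))
  rw [approxPoly, coeff_sub, coeff_sub, coeff_X_pow, coeff_X, coeff_C]
  refine (natDegree_sub_le_of_le (n := D ^ N) (natDegree_sub_le_of_le (n := D ^ N)
    (m := D ^ N) ?_ ?_) ?_).trans (by simp)
  · split_ifs <;> simp
  · split_ifs <;> simp
  · split_ifs
    · exact h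
    · simp

theorem coeff_seriesEval_approxPoly (ξ : PowerSeries F) (D N m : ℕ) :
    PowerSeries.coeff m (seriesEval ξ (approxPoly ξ D N)) =
      if m ≤ D ^ N then 0 else PowerSeries.coeff m (ξ ^ D - ξ) := by
  have : seriesEval ξ (approxPoly ξ D N) =
      (ξ ^ D - ξ) - (PowerSeries.trunc (D ^ N + 1) (ξ ^ D - ξ) : F[X]) := by
    simp [seriesEval, approxPoly]
  rw [this, map_sub, coeff_coe, PowerSeries.coeff_trunc]
  simp only [Nat.lt_succ_iff]
  split_ifs <;> simp

theorem approxPoly_sub_approxPoly (ξ : PowerSeries F) (D M N : ℕ) :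
    approxPoly ξ D M - approxPoly ξ D N = C (PowerSeries.trunc (D ^ N + 1) (ξ ^ D - ξ) -
      PowerSeries.trunc (D ^ M + 1) (ξ ^ D - ξ)) := by
  rw [approxPoly, approxPoly, C_sub]; ring

/-- If `ξ ^ D - ξ` is lacunary in base `D`, without long gaps, then the values at `ξ` of
polynomials of degree less than `D` are not too small. -/
theorem exists_order_seriesEval_le (ξ : PowerSeries F) {D n : ℕ} (hD : 2 ≤ D) (hn : n < D)
    (hgap : ∀ N m, 1 ≤ N → D ^ N < m → m < D ^ (N + 1) → PowerSeries.coeff m (ξ ^ D - ξ) = 0)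
    (hjump : ∀ N, ∃ M, N < M ∧ M ≤ N + 4 ∧ PowerSeries.coeff (D ^ M) (ξ ^ D - ξ) ≠ 0) :
    ∃ W B : ℕ, ∀ p : F[X][X], p ≠ 0 → p.natDegree ≤ n →
      (seriesEval ξ p).order ≤ ((W * innerDegree p + B * p.natDegree : ℕ) : ℕ∞) := by
  refine ⟨n * D ^ 6 + D, n * D ^ 6, order_seriesEval_le_of_irreducible ξ n _ _ (by omega) ?_⟩
  intro p hp hdeg hpn
  set a := innerDegree p with ha
  have hND : D * a < D ^ (Nat.log D a + 2) := by
    have := Nat.lt_pow_succ_log_self (b := D) (by omega) a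
    rw [pow_succ' D (Nat.log D a + 1)]
    exact Nat.mul_lt_mul_of_pos_left this (by omega)
  have hsmall : ∀ M, Nat.log D a + 2 ≤ M → M ≤ Nat.log D a + 6 → ¬ p ∣ approxPoly ξ D M →
      (seriesEval ξ p).order ≤ (((n * D ^ 6 + D) * a + n * D ^ 6 : ℕ) : ℕ∞) := by
    intro M hM1 hM2 hdvd
    have hpow : D * a < D ^ M := hND.trans_le (Nat.pow_le_pow_right (by omega) hM1)
    have hupper : D ^ M ≤ (a + 1) * D ^ 6 := by
      refine (Nat.pow_le_pow_right (by omega) hM2).trans ?_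
      rw [pow_add]
      exact Nat.mul_le_mul_right _ (Nat.pow_log_le_add_one D a)
    refine (order_seriesEval_le_of_not_dvd ξ hp hdeg hdvd (natDegree_coeff_le_innerDegree p)
      (natDegree_coeff_approxPoly_le ξ D M) ?_).trans ?_
    · rw [natDegree_approxPoly ξ hD]
      have h1 : p.natDegree * D ^ M + D * a < D ^ (M + 1) := by
        have : (p.natDegree + 1) * D ^ M ≤ D * D ^ M := Nat.mul_le_mul_right _ (by omega)
        rw [pow_succ']
        linarith
      refine lt_of_lt_of_le (by exact_mod_cast h1) (PowerSeries.nat_le_order _ _ fun i hi => ?_)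
      rw [coeff_seriesEval_approxPoly]
      split_ifs with h
      · rfl
      · exact hgap M i (by omega) (by omega) hi
    · rw [natDegree_approxPoly ξ hD]
      have h2 : p.natDegree * D ^ M ≤ n * ((a + 1) * D ^ 6) := Nat.mul_le_mul hpn hupper
      have h3 : p.natDegree * D ^ M + D * a ≤ (n * D ^ 6 + D) * a + n * D ^ 6 := by
        refine (Nat.add_le_add_right h2 _).trans (le_of_eq ?_)
        ring
      exact_mod_cast h3
  obtain ⟨M, hM1, hM2, hM⟩ := hjump (Nat.log D a + 2)
  by_cases h1 : p ∣ approxPoly ξ D (Nat.log D a + 2)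
  · refine hsmall M (by omega) (by omega) fun h2 => hdeg ?_
    have hd := dvd_sub h1 h2
    rw [approxPoly_sub_approxPoly] at hd
    have hlt : D ^ (Nat.log D a + 2) < D ^ M := Nat.pow_lt_pow_right (by omega) hM1
    have hne : PowerSeries.trunc (D ^ M + 1) (ξ ^ D - ξ) -
        PowerSeries.trunc (D ^ (Nat.log D a + 2) + 1) (ξ ^ D - ξ) ≠ 0 := by
      intro h
      have := congrArg (fun c => coeff c (D ^ M)) h
      simp only [coeff_sub, PowerSeries.coeff_trunc, coeff_zero] at this
      rw [if_pos (by omega), if_neg (by omega), sub_zero] at this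
      exact hM this
    have := natDegree_le_of_dvd hd (C_ne_zero.2 hne)
    rwa [natDegree_C, Nat.le_zero] at this
  · exact hsmall _ le_rfl (by omega) h1

theorem order_ofPowerSeries {y : PowerSeries F} (hy : y ≠ 0) :
    (HahnSeries.ofPowerSeries ℤ F y).order = y.order.toNat := by
  have h0 : HahnSeries.ofPowerSeries ℤ F y ≠ 0 := by
    simpa using (HahnSeries.ofPowerSeries_injective (Γ := ℤ) (R := F)).ne hy
  refine le_antisymm (HahnSeries.order_le_of_coeff_ne_zero ?_) ?_
  · rw [HahnSeries.ofPowerSeries_apply_coeff]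
    exact PowerSeries.coeff_order hy
  · have h1 := HahnSeries.coeff_order_eq_zero.not.2 h0
    rw [PowerSeries.coeff_coe] at h1
    split_ifs at h1 with h2
    · exact absurd rfl h1
    · have := PowerSeries.order_le _ h1
      have := ENat.toNat_le_of_le_natCast this
      omega

/-- The exponents `e` such that `u ^ (2 ^ e)` occurs in the series. -/
def IsEvenVal (e : ℕ) : Prop := ∃ k l : ℕ, Odd l ∧ e = 4 ^ k * l

theorem isEvenVal_two_pow_mul {v l : ℕ} (hl : Odd l) : IsEvenVal (2 ^ v * l) ↔ Even v := by
  constructor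
  · rintro ⟨k, m, hm, h⟩
    have hval : ∀ a b : ℕ, Odd b → (2 ^ a * b).factorization 2 = a := by
      intro a b hb
      rw [Nat.factorization_mul (by positivity) hb.pos.ne', Nat.factorization_pow]
      simp [Nat.Prime.factorization Nat.prime_two,
        Nat.factorization_eq_zero_of_not_dvd hb.not_two_dvd_nat]
    have h2 := congrArg (fun x => x.factorization 2) h
    rw [show (4 : ℕ) = 2 ^ 2 from rfl, ← pow_mul] at h2
    simp only [hval _ _ hl, hval _ _ hm] at h2
    exact ⟨k, by omega⟩
  · rintro ⟨k, rfl⟩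
    exact ⟨k, l, hl, by rw [← two_mul, pow_mul]; norm_num⟩

theorem isEvenVal_add_two_pow {J e : ℕ} (he : ¬ 2 ^ J ∣ e) :
    IsEvenVal (e + 2 ^ J) ↔ IsEvenVal e := by
  have he0 : e ≠ 0 := by rintro rfl; simp at he
  obtain ⟨v, l, hl, rfl⟩ := Nat.exists_eq_two_pow_mul_odd he0
  have hv : v < J := by
    by_contra! h
    exact he ((pow_dvd_pow 2 h).mul_right l)
  obtain ⟨c, rfl⟩ := Nat.exists_eq_add_of_lt hv
  have : 2 ^ v * l + 2 ^ (v + c + 1) = 2 ^ v * (l + 2 * 2 ^ c) := by ring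
  rw [this, isEvenVal_two_pow_mul hl, isEvenVal_two_pow_mul (hl.add_even (by simp))]

/-- The power series `∑ u ^ (2 ^ e)` over all `e` of even `2`-adic valuation. -/
def evenValSeries : PowerSeries (ZMod 2) :=
  PowerSeries.mk fun n => if ∃ e, IsEvenVal e ∧ n = 2 ^ e then 1 else 0

theorem coeff_two_pow_evenValSeries (e : ℕ) :
    PowerSeries.coeff (2 ^ e) evenValSeries = if IsEvenVal e then 1 else 0 := by
  rw [evenValSeries, PowerSeries.coeff_mk]
  congr 1
  refine propext ⟨?_, fun h => ⟨e, h, rfl⟩⟩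
  rintro ⟨f, hf, h⟩
  rwa [Nat.pow_right_injective le_rfl h]

theorem coeff_evenValSeries_of_ne {n : ℕ} (h : ∀ e, n ≠ 2 ^ e) :
    PowerSeries.coeff n evenValSeries = 0 := by
  rw [evenValSeries, PowerSeries.coeff_mk, if_neg]
  rintro ⟨e, -, he⟩
  exact h e he

theorem coeff_pow_two_pow (f : PowerSeries (ZMod 2)) (s m : ℕ) :
    PowerSeries.coeff m (f ^ 2 ^ s) =
      if 2 ^ s ∣ m then PowerSeries.coeff (m / 2 ^ s) f else 0 := by
  have h : PowerSeries.map (iterateFrobenius (ZMod 2) 2 s)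
      (PowerSeries.expand (2 ^ s) (by simp) f) = f ^ 2 ^ s :=
    MvPowerSeries.map_iterateFrobenius_expand 2 two_ne_zero f s
  rw [← h, PowerSeries.coeff_map, PowerSeries.coeff_expand]
  simp [iterateFrobenius_def, ZMod.pow_card_pow]

theorem coeff_two_pow_add_evenValSeries (e s : ℕ) :
    PowerSeries.coeff (2 ^ (e + s)) (evenValSeries ^ 2 ^ s - evenValSeries) =
      (if IsEvenVal e then 1 else 0) - (if IsEvenVal (e + s) then 1 else 0) := by
  rw [map_sub, coeff_pow_two_pow, coeff_two_pow_evenValSeries, if_pos (by simp [pow_add]),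
    pow_add, Nat.mul_div_cancel _ (by positivity), coeff_two_pow_evenValSeries]

theorem coeff_evenValSeries_gap (J N m : ℕ) (hN : 1 ≤ N) (h1 : (2 ^ 2 ^ J) ^ N < m)
    (h2 : m < (2 ^ 2 ^ J) ^ (N + 1)) :
    PowerSeries.coeff m (evenValSeries ^ 2 ^ 2 ^ J - evenValSeries) = 0 := by
  by_cases hm : ∃ e, m = 2 ^ e
  · obtain ⟨e, rfl⟩ := hm
    rw [← pow_mul] at h1 h2
    replace h1 := (Nat.pow_lt_pow_iff_right (by norm_num)).1 h1
    replace h2 := (Nat.pow_lt_pow_iff_right (by norm_num)).1 h2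
    have hle : 2 ^ J ≤ e := (Nat.le_mul_of_pos_right _ hN).trans h1.le
    obtain ⟨f, rfl⟩ := Nat.exists_eq_add_of_le' hle
    rw [coeff_two_pow_add_evenValSeries]
    have hf : ¬ 2 ^ J ∣ f := by
      rintro ⟨c, rfl⟩
      rw [← Nat.mul_succ] at h1 h2
      have := Nat.lt_of_mul_lt_mul_left h1
      have := Nat.lt_of_mul_lt_mul_left h2
      omega
    simp [isEvenVal_add_two_pow hf]
  · push Not at hm
    rw [map_sub, coeff_pow_two_pow, coeff_evenValSeries_of_ne hm, sub_zero]
    split_ifs with hd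
    · obtain ⟨c, rfl⟩ := hd
      rw [Nat.mul_div_cancel_left _ (by positivity)]
      refine coeff_evenValSeries_of_ne fun e he => hm (2 ^ J + e) ?_
      rw [he, pow_add]
    · rfl

theorem coeff_evenValSeries_node (J f : ℕ) :
    PowerSeries.coeff ((2 ^ 2 ^ J) ^ (f + 1)) (evenValSeries ^ 2 ^ 2 ^ J - evenValSeries) =
      (if IsEvenVal (2 ^ J * f) then 1 else 0) -
        (if IsEvenVal (2 ^ J * (f + 1)) then 1 else 0) := by
  rw [← pow_mul, Nat.mul_succ, coeff_two_pow_add_evenValSeries]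

theorem isEvenVal_two_pow_mul_four_mul_add_two (J t : ℕ) :
    IsEvenVal (2 ^ J * (4 * t + 2)) ↔ ¬ Even J := by
  rw [show 2 ^ J * (4 * t + 2) = 2 ^ (J + 1) * (2 * t + 1) by ring,
    isEvenVal_two_pow_mul (odd_two_mul_add_one t), Nat.even_add_one]

theorem isEvenVal_two_pow_mul_eight_mul_add_four (J t : ℕ) :
    IsEvenVal (2 ^ J * (8 * t + 4)) ↔ Even J := by
  rw [show 2 ^ J * (8 * t + 4) = 2 ^ (J + 2) * (2 * t + 1) by ring,
    isEvenVal_two_pow_mul (odd_two_mul_add_one t)]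
  simp [Nat.even_add]

theorem coeff_evenValSeries_node_four_mul_add_three (J t : ℕ) :
    PowerSeries.coeff ((2 ^ 2 ^ J) ^ (4 * t + 3)) (evenValSeries ^ 2 ^ 2 ^ J - evenValSeries)
      ≠ 0 := by
  rw [coeff_evenValSeries_node J (4 * t + 2), isEvenVal_two_pow_mul_four_mul_add_two,
    isEvenVal_two_pow_mul ⟨2 * t + 1, by ring⟩]
  split_ifs <;> simp

theorem coeff_evenValSeries_node_eight_mul_add_four (J t : ℕ) :
    PowerSeries.coeff ((2 ^ 2 ^ J) ^ (8 * t + 4)) (evenValSeries ^ 2 ^ 2 ^ J - evenValSeries)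
      = 0 := by
  rw [coeff_evenValSeries_node J (8 * t + 3), isEvenVal_two_pow_mul_eight_mul_add_four,
    isEvenVal_two_pow_mul ⟨4 * t + 1, by ring⟩]
  simp

theorem coeff_evenValSeries_node_eight_mul_add_five (J t : ℕ) :
    PowerSeries.coeff ((2 ^ 2 ^ J) ^ (8 * t + 5)) (evenValSeries ^ 2 ^ 2 ^ J - evenValSeries)
      = 0 := by
  rw [coeff_evenValSeries_node J (8 * t + 4), isEvenVal_two_pow_mul_eight_mul_add_four,
    isEvenVal_two_pow_mul (l := 8 * t + 4 + 1) ⟨4 * t + 2, by ring⟩]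
  simp

theorem coeff_evenValSeries_node_eight_mul_add_six (J t : ℕ) :
    PowerSeries.coeff ((2 ^ 2 ^ J) ^ (8 * t + 6)) (evenValSeries ^ 2 ^ 2 ^ J - evenValSeries)
      ≠ 0 := by
  rw [coeff_evenValSeries_node J (8 * t + 5), isEvenVal_two_pow_mul ⟨4 * t + 2, by ring⟩,
    show 8 * t + 5 + 1 = 4 * (2 * t + 1) + 2 by ring, isEvenVal_two_pow_mul_four_mul_add_two]
  split_ifs <;> simp

theorem seriesEval_approxPoly_evenValSeries_ne_zero (J t : ℕ) :
    seriesEval evenValSeries (approxPoly evenValSeries (2 ^ 2 ^ J) (8 * t + 3)) ≠ 0 := by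
  intro h
  have h1 := coeff_seriesEval_approxPoly evenValSeries (2 ^ 2 ^ J) (8 * t + 3)
    ((2 ^ 2 ^ J) ^ (8 * t + 6))
  have hD : 1 < 2 ^ 2 ^ J := Nat.one_lt_two_pow (by positivity)
  rw [h, map_zero, if_neg (not_le.2 (Nat.pow_lt_pow_right hD (by omega)))] at h1
  exact coeff_evenValSeries_node_eight_mul_add_six J t h1.symm

theorem le_order_seriesEval_approxPoly_evenValSeries (J t : ℕ) :
    (((2 ^ 2 ^ J) ^ (8 * t + 6) : ℕ) : ℕ∞) ≤
      (seriesEval evenValSeries (approxPoly evenValSeries (2 ^ 2 ^ J) (8 * t + 3))).order := by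
  refine PowerSeries.nat_le_order _ _ fun m hm => ?_
  rw [coeff_seriesEval_approxPoly]
  split_ifs with h3
  · rfl
  rcases lt_trichotomy m ((2 ^ 2 ^ J) ^ (8 * t + 4)) with h4 | rfl | h4
  · exact coeff_evenValSeries_gap J _ m (by omega) (not_le.1 h3) h4
  · exact coeff_evenValSeries_node_eight_mul_add_four J t
  rcases lt_trichotomy m ((2 ^ 2 ^ J) ^ (8 * t + 5)) with h5 | rfl | h5
  · exact coeff_evenValSeries_gap J _ m (by omega) h4 h5
  · exact coeff_evenValSeries_node_eight_mul_add_five J t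
  · exact coeff_evenValSeries_gap J _ m (by omega) h5 hm

theorem exists_order_seriesEval_evenValSeries_le (n : ℕ) :
    ∃ W B : ℕ, ∀ p : (ZMod 2)[X][X], p ≠ 0 → p.natDegree ≤ n →
      (seriesEval evenValSeries p).order ≤
        ((W * innerDegree p + B * p.natDegree : ℕ) : ℕ∞) := by
  refine exists_order_seriesEval_le evenValSeries (D := 2 ^ 2 ^ n) ?_ ?_
    (coeff_evenValSeries_gap n) fun N => ?_
  · exact Nat.le_self_pow (by positivity) 2
  · exact Nat.lt_two_pow_self.trans Nat.lt_two_pow_self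
  · exact ⟨4 * ((N + 1) / 4) + 3, by omega, by omega,
      coeff_evenValSeries_node_four_mul_add_three n _⟩

/-- The polynomial obtained by applying `Polynomial.reflect h` to every coefficient. -/
def reflectCoeffs (h : ℕ) (P : F[X][X]) : F[X][X] :=
  P.sum fun i c => monomial i (reflect h c)

theorem coeff_reflectCoeffs (h : ℕ) (P : F[X][X]) (i : ℕ) :
    (reflectCoeffs h P).coeff i = reflect h (P.coeff i) := by
  rw [reflectCoeffs, Polynomial.sum, finsetSum_coeff]
  simp only [coeff_monomial, Finset.sum_ite_eq']
  split_ifs with hi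
  · rfl
  · rw [notMem_support_iff.1 hi, reflect_zero]

theorem natDegree_reflectCoeffs_le (h : ℕ) (P : F[X][X]) :
    (reflectCoeffs h P).natDegree ≤ P.natDegree := by
  refine natDegree_le_iff_coeff_eq_zero.2 fun N hN => ?_
  rw [coeff_reflectCoeffs, coeff_eq_zero_of_natDegree_lt hN, reflect_zero]

theorem reflectCoeffs_reflectCoeffs (h : ℕ) (P : F[X][X]) :
    reflectCoeffs h (reflectCoeffs h P) = P := by
  ext1 i
  simp [coeff_reflectCoeffs]

theorem natDegree_coeff_reflectCoeffs_le {h : ℕ} {P : F[X][X]}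
    (hP : ∀ i, (P.coeff i).natDegree ≤ h) (i : ℕ) :
    ((reflectCoeffs h P).coeff i).natDegree ≤ h := by
  rw [coeff_reflectCoeffs]
  exact natDegree_reflect_le.trans (max_le le_rfl (hP i))

theorem eval₂_single_one (c : F[X]) :
    eval₂ (HahnSeries.C : F →+* LaurentSeries F) (HahnSeries.single (1 : ℤ) (1 : F)) c =
      HahnSeries.ofPowerSeries ℤ F (c : PowerSeries F) := by
  induction c using Polynomial.induction_on' with
  | add p q hp hq => simp [hp, hq]
  | monomial n a =>
    rw [← C_mul_X_pow_eq_monomial, eval₂_mul, eval₂_C, eval₂_X_pow, coe_mul, coe_C, coe_pow,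
      coe_X, map_mul, map_pow, HahnSeries.ofPowerSeries_C, HahnSeries.ofPowerSeries_X]

section LaurentSeries

variable {Fq : Type} [Field Fq]

theorem ringHomT_reflect {h : ℕ} {c : Fq[X]} (hc : c.natDegree ≤ h) :
    ringHomT Fq (reflect h c) =
      Tel Fq ^ h * HahnSeries.ofPowerSeries ℤ Fq (c : PowerSeries Fq) := by
  have hne : (HahnSeries.single (1 : ℤ) (1 : Fq) : LaurentSeries Fq) ≠ 0 := by simp
  let := invertibleOfNonzero hne
  have := eval₂_reflect_mul_pow (HahnSeries.C : Fq →+* LaurentSeries Fq)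
    (HahnSeries.single (1 : ℤ) (1 : Fq)) h c hc
  rw [eval₂_single_one, invOf_eq_inv] at this
  rw [← this, mul_comm, mul_assoc, Tel, ← mul_pow, mul_inv_cancel₀ hne, one_pow, mul_one]
  rfl

theorem evalP_reflectCoeffs (ξ : PowerSeries Fq) {h : ℕ} {p : Fq[X][X]}
    (hp : ∀ i, (p.coeff i).natDegree ≤ h) :
    evalP Fq (HahnSeries.ofPowerSeries ℤ Fq ξ) (reflectCoeffs h p) =
      Tel Fq ^ h * HahnSeries.ofPowerSeries ℤ Fq (seriesEval ξ p) := by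
  rw [evalP, eval₂_eq_sum_range' _ (Nat.lt_succ_of_le (natDegree_reflectCoeffs_le h p)),
    seriesEval, coe_eval₂RingHom, eval₂_eq_sum_range, map_sum, Finset.mul_sum]
  refine Finset.sum_congr rfl fun i _ => ?_
  rw [coeff_reflectCoeffs, ringHomT_reflect (hp i), map_mul, map_pow, mul_assoc]
  rfl

theorem absL_evalP_reflectCoeffs (q : ℕ) (ξ : PowerSeries Fq) {h : ℕ} {p : Fq[X][X]}
    (hp : ∀ i, (p.coeff i).natDegree ≤ h) (hne : seriesEval ξ p ≠ 0) :
    absL Fq q (evalP Fq (HahnSeries.ofPowerSeries ℤ Fq ξ) (reflectCoeffs h p)) =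
      (q : ℝ) ^ ((h : ℤ) - (seriesEval ξ p).order.toNat) := by
  have h1 : HahnSeries.ofPowerSeries ℤ Fq (seriesEval ξ p) ≠ 0 := by
    simpa using (HahnSeries.ofPowerSeries_injective (Γ := ℤ) (R := Fq)).ne hne
  have h2 : Tel Fq ^ h = HahnSeries.single (-(h : ℤ)) 1 := by
    rw [Tel, HahnSeries.inv_single, HahnSeries.single_pow]
    simp
  have h3 : (HahnSeries.single (-(h : ℤ)) 1 : LaurentSeries Fq) ≠ 0 := by simp
  rw [evalP_reflectCoeffs ξ hp, absL, h2, if_neg (mul_ne_zero h3 h1),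
    HahnSeries.order_mul h3 h1, HahnSeries.order_single one_ne_zero, order_ofPowerSeries hne]
  congr 1
  ring

theorem heightP_eq_pow_innerDegree (q : ℕ) {P : Fq[X][X]} (hP : P ≠ 0) :
    heightP Fq q P = (q : ℝ) ^ innerDegree P := by
  rw [heightP, if_neg hP]
  congr 1
  refine le_antisymm (Finset.sup_le fun i _ => natDegree_coeff_le_innerDegree P i)
    (innerDegree_le fun i => ?_)
  by_cases hi : i ∈ P.support
  · exact Finset.le_sup (f := fun i => (P.coeff i).natDegree) hi
  · simp [notMem_support_iff.1 hi]

theorem finite_setOf_innerDegree_eq_zero [Finite Fq] (n : ℕ) :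
    {P : Fq[X][X] | P.natDegree ≤ n ∧ innerDegree P = 0}.Finite := by
  refine Set.Finite.of_injOn (f := fun P (i : Fin (n + 1)) => (P.coeff i).coeff 0)
    (t := Set.univ) (fun _ _ => Set.mem_univ _) ?_ Set.finite_univ
  rintro P ⟨hP, hP'⟩ Q ⟨hQ, hQ'⟩ h
  ext i j
  have hz : ∀ R : Fq[X][X], innerDegree R = 0 → j ≠ 0 → (R.coeff i).coeff j = 0 := by
    intro R hR hj
    refine coeff_eq_zero_of_natDegree_lt ?_
    have := natDegree_coeff_le_innerDegree R i
    omega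
  by_cases hj : j = 0
  · subst hj
    by_cases hi : i < n + 1
    · exact congrFun h ⟨i, hi⟩
    · rw [coeff_eq_zero_of_natDegree_lt (by omega : P.natDegree < i),
        coeff_eq_zero_of_natDegree_lt (by omega : Q.natDegree < i)]
  · rw [hz P hP' hj, hz Q hQ' hj]

end LaurentSeries

theorem wn_evenValSeries_lt_top (n : ℕ) :
    wn (ZMod 2) 2 n (HahnSeries.ofPowerSeries ℤ (ZMod 2) evenValSeries) < ⊤ := by
  obtain ⟨W, B, hWB⟩ := exists_order_seriesEval_evenValSeries_le n
  refine lt_of_le_of_lt (sSup_le ?_) (EReal.coe_lt_top ((W + B * n : ℕ) : ℝ))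
  rintro _ ⟨w, hw, rfl⟩
  rw [EReal.coe_le_coe_iff]
  obtain ⟨P, ⟨hPn, hPpos, hPle⟩, hP0⟩ :=
    (hw.sdiff (finite_setOf_innerDegree_eq_zero (Fq := ZMod 2) n)).nonempty
  have hh : innerDegree P ≠ 0 := fun h => hP0 ⟨hPn, h⟩
  have hPne : P ≠ 0 := by rintro rfl; simp [innerDegree] at hh
  set h := innerDegree P with hdef
  have hcoeff : ∀ i, ((reflectCoeffs h P).coeff i).natDegree ≤ h :=
    natDegree_coeff_reflectCoeffs_le (natDegree_coeff_le_innerDegree P)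
  have hpne : reflectCoeffs h P ≠ 0 := by
    intro h0
    apply hPne
    rw [← reflectCoeffs_reflectCoeffs h P, h0]
    simp [reflectCoeffs]
  have hpdeg := natDegree_reflectCoeffs_le h P
  have hord := hWB _ hpne (hpdeg.trans hPn)
  have hev : seriesEval evenValSeries (reflectCoeffs h P) ≠ 0 := by
    intro h0
    rw [h0, PowerSeries.order_zero, top_le_iff] at hord
    exact ENat.natCast_ne_top _ hord
  have habs := absL_evalP_reflectCoeffs 2 evenValSeries hcoeff hev
  rw [reflectCoeffs_reflectCoeffs] at habs
  rw [habs, heightP_eq_pow_innerDegree 2 hPne, ← hdef] at hPle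
  replace hord := ENat.toNat_le_of_le_natCast hord
  have hbound : (seriesEval evenValSeries (reflectCoeffs h P)).order.toNat ≤ (W + B * n) * h := by
    refine hord.trans ?_
    have h1 := Nat.mul_le_mul_left W (innerDegree_le hcoeff)
    have h2 := Nat.mul_le_mul_left B (hpdeg.trans hPn)
    have h3 := Nat.le_mul_of_pos_right (B * n) (Nat.pos_of_ne_zero hh)
    rw [add_mul]
    omega
  rw [← Real.rpow_natCast, ← Real.rpow_mul (by norm_num), ← Real.rpow_intCast] at hPle
  push_cast at hPle
  rw [Real.rpow_le_rpow_left_iff (by norm_num)] at hPle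
  have hb : ((seriesEval evenValSeries (reflectCoeffs h P)).order.toNat : ℝ) ≤
      ((W + B * n : ℕ) : ℝ) * h := by exact_mod_cast hbound
  have hpos : (0 : ℝ) < h := by exact_mod_cast Nat.pos_of_ne_zero hh
  refine le_of_mul_le_mul_right ?_ hpos
  linarith

theorem le_wn_evenValSeries (J : ℕ) :
    ((((2 ^ 2 ^ J) ^ 2 : ℕ) : ℝ) : EReal) ≤
      wn (ZMod 2) 2 (2 ^ 2 ^ J) (HahnSeries.ofPowerSeries ℤ (ZMod 2) evenValSeries) := by
  refine le_sSup ⟨_, ?_, rfl⟩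
  set D := 2 ^ 2 ^ J with hDdef
  have hD : 2 ≤ D := Nat.le_self_pow (by positivity) 2
  have hlead : ∀ N, (reflectCoeffs (D ^ N) (approxPoly evenValSeries D N)).coeff D =
      X ^ D ^ N := by
    intro N
    have : (approxPoly evenValSeries D N).coeff D = 1 := by
      rw [approxPoly, coeff_sub, coeff_sub, coeff_X_pow_self, coeff_X_of_ne_one (by omega),
        coeff_C_of_ne_zero (by omega), sub_zero, sub_zero]
    rw [coeff_reflectCoeffs, this, reflect_one]
  refine Set.infinite_of_injective_forall_mem (f := fun t : ℕ =>
    reflectCoeffs (D ^ (8 * t + 3)) (approxPoly evenValSeries D (8 * t + 3))) ?_ fun t => ?_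
  · intro t t' h
    have h1 := congrArg (fun P => (P.coeff D).natDegree) h
    simp only [hlead, natDegree_X_pow] at h1
    have := Nat.pow_right_injective hD h1
    omega
  · have hev := seriesEval_approxPoly_evenValSeries_ne_zero J t
    have hord := le_order_seriesEval_approxPoly_evenValSeries J t
    rw [← hDdef] at hev hord
    set N := 8 * t + 3 with hN
    have habs := absL_evalP_reflectCoeffs 2 evenValSeries
      (natDegree_coeff_approxPoly_le evenValSeries D N) hev
    refine ⟨(natDegree_reflectCoeffs_le _ _).trans (natDegree_approxPoly _ hD _).le, ?_, ?_⟩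
    · rw [habs]; positivity
    have hne : reflectCoeffs (D ^ N) (approxPoly evenValSeries D N) ≠ 0 := by
      intro h0
      have := hlead N
      rw [h0, coeff_zero] at this
      exact pow_ne_zero _ X_ne_zero this.symm
    rw [habs, heightP_eq_pow_innerDegree 2 hne, ← Real.rpow_natCast,
      ← Real.rpow_mul (by norm_num), ← Real.rpow_intCast]
    push_cast
    rw [Real.rpow_le_rpow_left_iff (by norm_num)]
    have hinner : innerDegree (reflectCoeffs (D ^ N) (approxPoly evenValSeries D N)) ≤ D ^ N :=
      innerDegree_le (natDegree_coeff_reflectCoeffs_le (natDegree_coeff_approxPoly_le _ D N))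
    rw [← PowerSeries.coe_toNat_order hev, Nat.cast_le] at hord
    have key : innerDegree (reflectCoeffs (D ^ N) (approxPoly evenValSeries D N)) * D ^ 2 +
        D ^ N ≤ (seriesEval evenValSeries (approxPoly evenValSeries D N)).order.toNat := by
      refine le_trans ?_ hord
      rw [show 8 * t + 6 = N + 3 by omega]
      calc _ ≤ D ^ N * D ^ 2 + D ^ N := by gcongr
        _ = D ^ N * (D ^ 2 + 1) := by ring
        _ ≤ D ^ N * D ^ 3 := Nat.mul_le_mul_left _ (by nlinarith [Nat.pow_le_pow_left hD 2])
        _ = D ^ (N + 3) := by ring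
    have key' : (innerDegree (reflectCoeffs (D ^ N) (approxPoly evenValSeries D N)) : ℝ) *
        (D : ℝ) ^ 2 + (D : ℝ) ^ N ≤
        ((seriesEval evenValSeries (approxPoly evenValSeries D N)).order.toNat : ℝ) := by
      exact_mod_cast key
    linarith

theorem wB_evenValSeries :
    wB (ZMod 2) 2 (HahnSeries.ofPowerSeries ℤ (ZMod 2) evenValSeries) = ⊤ := by
  rw [EReal.eq_top_iff_forall_lt]
  intro y
  obtain ⟨K, hK⟩ := exists_nat_gt y
  refine lt_of_lt_of_le (EReal.coe_lt_coe_iff.2 hK) (Filter.le_limsup_of_frequently_le ?_)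
  rw [Filter.frequently_atTop]
  intro n
  have hlt : n + K < 2 ^ 2 ^ (n + K) := Nat.lt_two_pow_self.trans Nat.lt_two_pow_self
  refine ⟨2 ^ 2 ^ (n + K), by omega, ?_⟩
  refine le_trans ?_ (EReal.div_le_div_right_of_nonneg (by positivity)
    (le_wn_evenValSeries (n + K)))
  set D := 2 ^ 2 ^ (n + K) with hD
  have hDpos : (D : ℝ) ≠ 0 := by
    have : D ≠ 0 := by omega
    exact_mod_cast this
  rw [← EReal.coe_natCast (n := D), ← EReal.coe_div, EReal.coe_le_coe_iff]
  push_cast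
  rw [pow_two, mul_div_cancel_right₀ _ hDpos]
  exact_mod_cast (by omega : K ≤ D)

theorem evenValSeries_eq_mk : evenValSeries = PowerSeries.mk fun n : ℕ =>
    if ∃ k ℓ : ℕ, Odd ℓ ∧ 1 ≤ ℓ ∧ n = 2 ^ (4 ^ k * ℓ) then (1 : ZMod 2) else 0 := by
  ext n
  rw [evenValSeries, PowerSeries.coeff_mk, PowerSeries.coeff_mk]
  congr 1
  refine propext ⟨?_, ?_⟩
  · rintro ⟨_, ⟨k, l, hl, rfl⟩, rfl⟩
    exact ⟨k, l, hl, hl.pos, rfl⟩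
  · rintro ⟨k, l, hl, -, rfl⟩
    exact ⟨_, ⟨k, l, hl, rfl⟩, rfl⟩

end OotoT

/-- With `a_n = 1` iff `n = 2^{4^k ℓ}` for some `k ≥ 0` and odd `ℓ ≥ 1`,
the Laurent series `Σ_{n=0}^∞ a_n T^{-n} ∈ F_2((T⁻¹))` is a `T`-number. -/
theorem explicit_example_isTNumber :
    IsTNumber (ZMod 2) 2
      (HahnSeries.ofPowerSeries ℤ (ZMod 2) (PowerSeries.mk fun n : ℕ =>
        if ∃ k ℓ : ℕ, Odd ℓ ∧ 1 ≤ ℓ ∧ n = 2 ^ (4 ^ k * ℓ) then (1 : ZMod 2) else 0)) := by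
  rw [← evenValSeries_eq_mk]
  exact ⟨wB_evenValSeries, fun n _ => wn_evenValSeries_lt_top n⟩
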